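/- arXiv:1912.06614 — 2 statements merged into one kernel-verified Lean document; each statement's English description precedes it below -/
import Mathlib

section
/- Let 0 < α ≤ 1, λ > 0, and let L(τ) = ντ + c be a linear polynomial. Then for 0 ≤ a ≤ b ≤ t, λ ∫_a^b (t−τ)^{α−1} E_{α,α}(−λ(t−τ)^α) L(τ) dτ = Ψ(b) − Ψ(a), where Ψ(τ) = E_α(−λ(t−τ)^α) L(τ) + ν (t−τ) E_{α,2}(−λ(t−τ)^α). -/
open Real

/-- The two-parameter Mittag-Leffler function. -/
noncomputable def mlE (α β z : ℝ) : ℝ := ∑' k : ℕ, z ^ k / Real.Gamma (α * k + β)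

lemma Real.rpow_mul_exp_neg_le_Gamma {M x : ℝ} (hM : 0 < M) (hx : 1 ≤ x) :
    M ^ (x - 1) * exp (-M) ≤ Real.Gamma x := by
  have hint := Real.GammaIntegral_convergent (zero_lt_one.trans_le hx)
  have hsub : Set.Ioi M ⊆ Set.Ioi 0 := Set.Ioi_subset_Ioi hM.le
  calc M ^ (x - 1) * exp (-M)
      = ∫ u in Set.Ioi M, exp (-u) * M ^ (x - 1) := by
        rw [MeasureTheory.integral_mul_const, integral_exp_neg_Ioi, mul_comm]
    _ ≤ ∫ u in Set.Ioi M, exp (-u) * u ^ (x - 1) := by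
        refine MeasureTheory.setIntegral_mono_on ((integrableOn_exp_neg_Ioi M).mul_const _)
          (hint.mono_set hsub) measurableSet_Ioi fun u hu => ?_
        have hMu : M ≤ u := le_of_lt hu
        have : 0 ≤ x - 1 := by linarith
        gcongr
    _ ≤ ∫ u in Set.Ioi 0, exp (-u) * u ^ (x - 1) := by
        refine MeasureTheory.setIntegral_mono_set hint ?_ hsub.eventuallyLE
        filter_upwards [MeasureTheory.ae_restrict_mem measurableSet_Ioi] with u hu
        have hu' : 0 < u := hu
        simp only [Pi.zero_apply]
        positivity
    _ = Real.Gamma x := (Real.Gamma_eq_integral (zero_lt_one.trans_le hx)).symm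

lemma summable_nat_mul_pow_div_Gamma {α : ℝ} (hα : 0 < α) (β : ℝ) {R : ℝ} (hR : 0 < R) :
    Summable fun k : ℕ => (k : ℝ) * R ^ k / Real.Gamma (α * k + β) := by
  set M : ℝ := (2 * R) ^ α⁻¹ with hM
  have hMpos : 0 < M := by positivity
  have hMα : M ^ α = 2 * R := Real.rpow_inv_rpow (by positivity) hα.ne'
  have hgeo : Summable fun k : ℕ => (k : ℝ) * (1 / 2 : ℝ) ^ k := by
    simpa using summable_pow_mul_geometric_of_norm_lt_one 1
      (show ‖(1 / 2 : ℝ)‖ < 1 by norm_num)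
  refine summable_of_isBigO_nat hgeo
    (Asymptotics.IsBigO.of_bound (M ^ (β - 1) * exp (-M))⁻¹ ?_)
  have hlarge : ∀ᶠ k : ℕ in Filter.atTop, 1 - β ≤ α * k :=
    (tendsto_natCast_atTop_atTop.const_mul_atTop hα).eventually_ge_atTop _
  filter_upwards [hlarge] with k hk
  have hΓ := Real.rpow_mul_exp_neg_le_Gamma (x := α * k + β) hMpos (by linarith)
  have hpow : M ^ (α * k + β - 1) = (2 * R) ^ k * M ^ (β - 1) := by
    rw [add_sub_assoc, Real.rpow_add hMpos, Real.rpow_mul hMpos.le, hMα, Real.rpow_natCast]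
  rw [hpow] at hΓ
  have hlow : 0 < (2 * R) ^ k * M ^ (β - 1) * exp (-M) := by positivity
  have hΓpos := hlow.trans_le hΓ
  rw [Real.norm_of_nonneg (by positivity), Real.norm_of_nonneg (by positivity)]
  calc (k : ℝ) * R ^ k / Real.Gamma (α * k + β)
      ≤ (k : ℝ) * R ^ k / ((2 * R) ^ k * M ^ (β - 1) * exp (-M)) := by gcongr
    _ = (M ^ (β - 1) * exp (-M))⁻¹ * ((k : ℝ) * (1 / 2) ^ k) := by
        rw [mul_pow, div_pow, one_pow]
        field_simp

lemma hasDerivAt_mlE {α : ℝ} (hα : 0 < α) (β z : ℝ) :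
    Summable (fun k : ℕ => z ^ k / Real.Gamma (α * k + β)) ∧
    Summable (fun k : ℕ => (k : ℝ) * z ^ (k - 1) / Real.Gamma (α * k + β)) ∧
    HasDerivAt (mlE α β) (∑' k : ℕ, (k : ℝ) * z ^ (k - 1) / Real.Gamma (α * k + β)) z := by
  set R : ℝ := |z| + 1 with hRdef
  have hR : 0 < R := by positivity
  have hz : z ∈ Metric.ball (0 : ℝ) R := by simp [hRdef]
  have hu : Summable fun k : ℕ =>
      R⁻¹ * ‖(k : ℝ) * R ^ k / Real.Gamma (α * k + β)‖ :=
    (summable_nat_mul_pow_div_Gamma hα β hR).norm.mul_left _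
  have hg : ∀ (k : ℕ), ∀ y ∈ Metric.ball (0 : ℝ) R,
      HasDerivAt (fun w : ℝ => w ^ k / Real.Gamma (α * k + β))
        ((k : ℝ) * y ^ (k - 1) / Real.Gamma (α * k + β)) y :=
    fun k y _ => (hasDerivAt_pow k y).div_const _
  have hbound : ∀ (k : ℕ), ∀ y ∈ Metric.ball (0 : ℝ) R,
      ‖(k : ℝ) * y ^ (k - 1) / Real.Gamma (α * k + β)‖ ≤
        R⁻¹ * ‖(k : ℝ) * R ^ k / Real.Gamma (α * k + β)‖ := by
    intro k y hy
    have hy' : |y| ≤ R := by simpa using (Metric.mem_ball.1 hy).le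
    rcases k with _ | k
    · simp
    · simp only [norm_div, norm_mul, norm_pow, Real.norm_eq_abs, abs_of_pos hR,
        Nat.add_sub_cancel]
      rw [← mul_div_assoc, pow_succ,
        show R⁻¹ * (|((k + 1 : ℕ) : ℝ)| * (R ^ k * R)) = |((k + 1 : ℕ) : ℝ)| * R ^ k by
          field_simp]
      gcongr
  have h0 : Summable fun k : ℕ => (0 : ℝ) ^ k / Real.Gamma (α * k + β) :=
    summable_of_ne_finset_zero (s := {0}) fun k hk => by
      simp [show k ≠ 0 by simpa using hk]
  have hball : IsPreconnected (Metric.ball (0 : ℝ) R) := (convex_ball _ _).isPreconnected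
  have h0mem := Metric.mem_ball_self (x := (0 : ℝ)) hR
  exact ⟨summable_of_summable_hasDerivAt_of_isPreconnected hu Metric.isOpen_ball hball hg hbound
      h0mem h0 hz,
    hu.of_norm_bounded fun k => hbound k z hz,
    hasDerivAt_tsum_of_isPreconnected hu Metric.isOpen_ball hball hg hbound h0mem h0 hz⟩

lemma continuous_mlE {α : ℝ} (hα : 0 < α) (β : ℝ) : Continuous (mlE α β) :=
  continuous_iff_continuousAt.2 fun z => (hasDerivAt_mlE hα β z).2.2.continuousAt

lemma Real.sub_one_div_Gamma (x : ℝ) : (x - 1) / Real.Gamma x = 1 / Real.Gamma (x - 1) := by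
  rcases eq_or_ne (x - 1) 0 with hx | hx
  · simp [hx]
  · have h := Real.Gamma_add_one hx
    rw [sub_add_cancel] at h
    rw [h, div_mul_eq_div_div, div_self hx]

lemma mlE_sub_one {α : ℝ} (hα : 0 < α) (β z : ℝ) :
    (β - 1) * mlE α β z + α * z * deriv (mlE α β) z = mlE α (β - 1) z := by
  obtain ⟨hs, hs', hd⟩ := hasDerivAt_mlE hα β z
  rw [hd.deriv, mlE, mlE, ← tsum_mul_left, ← tsum_mul_left,
    ← (hs.mul_left _).tsum_add (hs'.mul_left _)]
  refine tsum_congr fun k => ?_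
  have hΓ := Real.sub_one_div_Gamma (α * k + β)
  have hz : (k : ℝ) * z ^ (k - 1) * z = k * z ^ k := by
    rcases k with _ | k
    · simp
    · rw [Nat.add_sub_cancel, pow_succ, mul_assoc]
  rw [← add_sub_assoc, div_eq_mul_one_div (z ^ k) (Real.Gamma (α * k + β - 1)), ← hΓ]
  linear_combination α / Real.Gamma (α * k + β) * hz

lemma mlE_zero {α : ℝ} (hα : 0 < α) (z : ℝ) : mlE α 0 z = z * mlE α α z := by
  rw [mlE, (hasDerivAt_mlE hα 0 z).1.tsum_eq_zero_add, mlE, ← tsum_mul_left]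
  simp only [pow_zero, Nat.cast_zero, mul_zero, add_zero, Real.Gamma_zero, div_zero, zero_add]
  refine tsum_congr fun k => ?_
  rw [pow_succ, Nat.cast_add, Nat.cast_one, mul_add, mul_one]
  ring

lemma hasDerivAt_rpow_mul_mlE {α : ℝ} (hα : 0 < α) (β c : ℝ) {s : ℝ} (hs : 0 < s) :
    HasDerivAt (fun s => s ^ (β - 1) * mlE α β (c * s ^ α))
      (s ^ (β - 2) * mlE α (β - 1) (c * s ^ α)) s := by
  have hpow : ∀ p : ℝ, HasDerivAt (fun s : ℝ => s ^ p) (p * s ^ (p - 1)) s :=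
    fun p => Real.hasDerivAt_rpow_const (Or.inl hs.ne')
  have hE : HasDerivAt (mlE α β) (deriv (mlE α β) (c * s ^ α)) (c * s ^ α) :=
    (hasDerivAt_mlE hα β _).2.2.differentiableAt.hasDerivAt
  refine ((hpow (β - 1)).mul (hE.comp s ((hpow α).const_mul c))).congr_deriv ?_
  have h1 : s ^ (β - 1) = s ^ (β - 2) * s := by
    rw [← Real.rpow_add_one hs.ne']; ring_nf
  have h2 : s ^ α = s ^ (α - 1) * s := by
    rw [← Real.rpow_add_one hs.ne']; ring_nf
  rw [← mlE_sub_one hα β, show β - 1 - 1 = β - 2 by ring, Function.comp_apply]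
  linear_combination (deriv (mlE α β) (c * s ^ α) * (c * (α * s ^ (α - 1)))) * h1
    - s ^ (β - 2) * α * c * deriv (mlE α β) (c * s ^ α) * h2

theorem collocation_integral_formula (α lam ν c a b t : ℝ)
    (hα : 0 < α) (hα1 : α ≤ 1) (hlam : 0 < lam)
    (ha : 0 ≤ a) (hab : a ≤ b) (hbt : b ≤ t) :
    lam * ∫ τ in a..b, (t - τ) ^ (α - 1) * mlE α α (-lam * (t - τ) ^ α) * (ν * τ + c) =
      (mlE α 1 (-lam * (t - b) ^ α) * (ν * b + c) + ν * (t - b) * mlE α 2 (-lam * (t - b) ^ α)) -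
      (mlE α 1 (-lam * (t - a) ^ α) * (ν * a + c) + ν * (t - a) * mlE α 2 (-lam * (t - a) ^ α)) := by
  have hcont : ∀ β, Continuous fun τ => mlE α β (-lam * (t - τ) ^ α) := fun β =>
    (continuous_mlE hα β).comp <| continuous_const.mul <|
      (continuous_const.sub continuous_id).rpow_const fun _ => Or.inr hα.le
  have hlin : Continuous fun τ => ν * τ + c := by fun_prop
  rw [← intervalIntegral.integral_const_mul]
  refine intervalIntegral.integral_eq_sub_of_hasDerivAt_of_le
    (f := fun τ => mlE α 1 (-lam * (t - τ) ^ α) * (ν * τ + c) +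
      ν * (t - τ) * mlE α 2 (-lam * (t - τ) ^ α)) hab ?_ ?_ ?_
  · have := hcont 1
    have := hcont 2
    exact Continuous.continuousOn (by fun_prop)
  · intro τ hτ
    have hs : 0 < t - τ := by linarith [hτ.2]
    have hsub : HasDerivAt (fun τ => t - τ) (-1) τ := (hasDerivAt_id τ).const_sub t
    have h1 : HasDerivAt (fun τ => mlE α 1 (-lam * (t - τ) ^ α))
        (lam * ((t - τ) ^ (α - 1) * mlE α α (-lam * (t - τ) ^ α))) τ := by
      have h := (hasDerivAt_rpow_mul_mlE hα 1 (-lam) hs).comp τ hsub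
      simp only [Function.comp_def, sub_self, Real.rpow_zero, one_mul, mlE_zero hα] at h
      refine h.congr_deriv ?_
      rw [show (1 : ℝ) - 2 = -1 by norm_num, sub_eq_add_neg α, Real.rpow_add hs]
      ring
    have h2 : HasDerivAt (fun τ => (t - τ) * mlE α 2 (-lam * (t - τ) ^ α))
        (-mlE α 1 (-lam * (t - τ) ^ α)) τ := by
      have h := (hasDerivAt_rpow_mul_mlE hα 2 (-lam) hs).comp τ hsub
      simp only [Function.comp_def, sub_self, Real.rpow_zero, one_mul,
        show (2 : ℝ) - 1 = 1 by norm_num, Real.rpow_one, mul_neg_one] at h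
      exact h
    have hL : HasDerivAt (fun τ => ν * τ + c) ν τ := by
      simpa using ((hasDerivAt_id τ).const_mul ν).add_const c
    have h := (h1.mul hL).add (h2.const_mul ν)
    simp only [← mul_assoc] at h
    refine h.congr_deriv ?_
    ring
  · have hrpow : IntervalIntegrable (fun τ => (t - τ) ^ (α - 1)) MeasureTheory.volume a b := by
      simpa using (intervalIntegral.intervalIntegrable_rpow' (a := t - a) (b := t - b)
        (r := α - 1) (by linarith)).comp_sub_left t
    exact ((hrpow.mul_continuousOn (hcont α).continuousOn).mul_continuousOn
      hlin.continuousOn).const_mul lam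
end

section
/- For 0 < α ≤ 1 there exists a constant C > 0 such that |E_{α,α}(−λ² s^α)| ≤ C/(1 + λ² s^α) for all λ ∈ ℝ and s > 0. -/
open Real

open Set Filter Topology MeasureTheory

section RealPowers

theorem integral_rpow_mul_sub_rpow {u v t : ℝ} (hu : 0 < u) (hv : 0 < v) (ht : 0 < t) :
    ∫ s in (0 : ℝ)..t, s ^ (u - 1) * (t - s) ^ (v - 1) =
      t ^ (u + v - 1) * ProbabilityTheory.beta u v := by
  have h := Complex.betaIntegral_scaled (u : ℂ) (v : ℂ) ht
  have hb : Complex.betaIntegral u v = ((ProbabilityTheory.beta u v : ℝ) : ℂ) := by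
    rw [Complex.betaIntegral_eq_Gamma_mul_div _ _ (by simpa) (by simpa), ProbabilityTheory.beta]
    simp only [← Complex.ofReal_add, Complex.Gamma_ofReal]
    push_cast
    rfl
  have hl : ∫ x in (0 : ℝ)..t, (x : ℂ) ^ ((u : ℂ) - 1) * ((t : ℂ) - x) ^ ((v : ℂ) - 1) =
      ((∫ s in (0 : ℝ)..t, s ^ (u - 1) * (t - s) ^ (v - 1) : ℝ) : ℂ) := by
    rw [← intervalIntegral.integral_ofReal]
    refine intervalIntegral.integral_congr fun s hs => ?_
    rw [uIcc_of_le ht.le] at hs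
    simp only [Complex.ofReal_mul]
    rw [Complex.ofReal_cpow hs.1, Complex.ofReal_cpow (sub_nonneg.2 hs.2)]
    push_cast
    rfl
  rw [hl, hb] at h
  have hp : (t : ℂ) ^ ((u : ℂ) + v - 1) = ((t ^ (u + v - 1) : ℝ) : ℂ) := by
    rw [Complex.ofReal_cpow ht.le]
    push_cast
    rfl
  rw [hp] at h
  exact_mod_cast h

theorem intervalIntegrable_rpow_mul_sub_rpow {u v t : ℝ} (hu : 0 < u) (hv : 0 < v) (ht : 0 < t) :
    IntervalIntegrable (fun s => s ^ (u - 1) * (t - s) ^ (v - 1)) volume 0 t := by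
  apply intervalIntegral.intervalIntegrable_of_integral_ne_zero
  rw [integral_rpow_mul_sub_rpow hu hv ht]
  exact (mul_pos (rpow_pos_of_pos ht _) (ProbabilityTheory.beta_pos hu hv)).ne'

theorem rpow_neg_tangent_bound {α a b : ℝ} (hα : 0 < α) (hb : 0 < b) (hab : b ≤ a) :
    α * (a - b) * a ^ (-α - 1) ≤ b ^ (-α) - a ^ (-α) := by
  have ha : 0 < a := hb.trans_le hab
  have hy : 0 < b / a := div_pos hb ha
  have h1 : 1 + α * (1 - b / a) ≤ (b / a) ^ (-α) := by
    rw [rpow_def_of_pos hy]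
    have h2 := add_one_le_exp (log (b / a) * -α)
    have h3 := log_le_sub_one_of_pos hy
    nlinarith
  rw [div_rpow hb.le ha.le, le_div_iff₀ (rpow_pos_of_pos ha _)] at h1
  have h4 : a ^ (-α - 1) = a ^ (-α) / a := by rw [rpow_sub ha, rpow_one]
  rw [h4]
  have h5 : α * (a - b) * (a ^ (-α) / a) = α * (1 - b / a) * a ^ (-α) := by
    field_simp
  rw [h5]
  linarith

end RealPowers

section MaximumPrinciple

/-- The fractional integral of order `1 - α`, without its normalizing constant. -/
noncomputable def fracInt (α : ℝ) (u : ℝ → ℝ) (t : ℝ) : ℝ :=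
  ∫ s in (0 : ℝ)..t, (t - s) ^ (-α) * u s

variable {α T : ℝ} {u : ℝ → ℝ}

theorem fracInt_sub_le {K : ℝ} (hα : 0 < α) (hα1 : α < 1) (hT : 0 < T) (hK0 : 0 ≤ K)
    (hint : ∀ t, 0 < t → IntervalIntegrable (fun s => (t - s) ^ (-α) * u s) volume 0 t)
    (hu : IntervalIntegrable u volume 0 T) (hpos : ∀ s ∈ Ioo 0 T, 0 < u s)
    {h : ℝ} (h0 : 0 < h) (hh : h < T / 2) (hK : ∀ s ∈ Ioo (T - h) T, u s ≤ K * (T - s)) :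
    fracInt α u T - fracInt α u (T - h) ≤
      -(α * T ^ (-α - 1) * ∫ s in (0 : ℝ)..T / 2, u s) * h + K * h ^ (1 - α) * h := by
  have hTh : 0 < T - h := by linarith
  have i1 : IntervalIntegrable (fun s => (T - s) ^ (-α) * u s) volume 0 (T - h) :=
    (hint T hT).mono_set (by
      rw [uIcc_of_le hTh.le, uIcc_of_le hT.le]; exact Icc_subset_Icc le_rfl (by linarith))
  have i2 : IntervalIntegrable (fun s => (T - s) ^ (-α) * u s) volume (T - h) T :=
    (hint T hT).mono_set (by
      rw [uIcc_of_le (by linarith), uIcc_of_le hT.le]; exact Icc_subset_Icc hTh.le le_rfl)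
  have i3 := hint (T - h) hTh
  have i4 : IntervalIntegrable u volume 0 (T - h) :=
    hu.mono_set (by
      rw [uIcc_of_le hTh.le, uIcc_of_le hT.le]; exact Icc_subset_Icc le_rfl (by linarith))
  have i5 : IntervalIntegrable u volume 0 (T / 2) :=
    hu.mono_set (by
      rw [uIcc_of_le (by linarith), uIcc_of_le hT.le]; exact Icc_subset_Icc le_rfl (by linarith))
  have i6 : IntervalIntegrable u volume (T / 2) (T - h) :=
    hu.mono_set (by
      rw [uIcc_of_le (by linarith), uIcc_of_le hT.le]
      exact Icc_subset_Icc (by linarith) (by linarith))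
  have hsplit : fracInt α u T - fracInt α u (T - h) =
      (∫ s in (0 : ℝ)..(T - h), ((T - s) ^ (-α) * u s - (T - h - s) ^ (-α) * u s)) +
        ∫ s in (T - h)..T, (T - s) ^ (-α) * u s := by
    rw [intervalIntegral.integral_sub i1 i3, fracInt, fracInt,
      ← intervalIntegral.integral_add_adjacent_intervals i1 i2]
    ring
  have hfar : ∫ s in (0 : ℝ)..(T - h), ((T - s) ^ (-α) * u s - (T - h - s) ^ (-α) * u s) ≤
      ∫ s in (0 : ℝ)..(T - h), -(α * h * T ^ (-α - 1)) * u s := by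
    refine intervalIntegral.integral_mono_on_of_le_Ioo hTh.le (i1.sub i3) (i4.const_mul _) ?_
    intro s hs
    have b1 := rpow_neg_tangent_bound hα (show 0 < T - h - s by linarith [hs.2])
      (show T - h - s ≤ T - s by linarith)
    have b2 : T ^ (-α - 1) ≤ (T - s) ^ (-α - 1) :=
      rpow_le_rpow_of_nonpos (by linarith [hs.2]) (by linarith [hs.1]) (by linarith)
    have b3 : α * h * T ^ (-α - 1) ≤ (T - h - s) ^ (-α) - (T - s) ^ (-α) := by
      refine le_trans ?_ b1
      rw [show T - s - (T - h - s) = h by ring]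
      gcongr
    have := mul_le_mul_of_nonneg_right b3 (hpos s ⟨hs.1, by linarith [hs.2]⟩).le
    linarith
  have hnear : ∫ s in (T - h)..T, (T - s) ^ (-α) * u s ≤ ∫ _ in (T - h)..T, K * h ^ (1 - α) := by
    refine intervalIntegral.integral_mono_on_of_le_Ioo (by linarith) i2 (by simp) ?_
    intro s hs
    have hs0 : 0 < T - s := by linarith [hs.2]
    calc (T - s) ^ (-α) * u s ≤ (T - s) ^ (-α) * (K * (T - s)) := by
          gcongr
          exact hK s hs
      _ = K * (T - s) ^ (1 - α) := by
          rw [show (1 : ℝ) - α = -α + 1 by ring, rpow_add_one hs0.ne']; ring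
      _ ≤ K * h ^ (1 - α) := by
          gcongr
          linarith [hs.1]
  have hmass : ∫ s in (0 : ℝ)..T / 2, u s ≤ ∫ s in (0 : ℝ)..(T - h), u s := by
    rw [← intervalIntegral.integral_add_adjacent_intervals i5 i6]
    have : 0 ≤ ∫ s in (T / 2)..(T - h), u s :=
      intervalIntegral.integral_nonneg (by linarith) fun s hs =>
        (hpos s ⟨by linarith [hs.1], by linarith [hs.2]⟩).le
    linarith
  rw [intervalIntegral.integral_const_mul] at hfar
  rw [intervalIntegral.integral_const, smul_eq_mul, sub_sub_cancel] at hnear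
  have hc : 0 ≤ α * h * T ^ (-α - 1) := by positivity
  nlinarith [mul_le_mul_of_nonneg_left hmass hc]

/-- At its first zero, a positive function has a fractional integral with negative derivative. -/
theorem fracInt_deriv_neg (hα : 0 < α) (hα1 : α < 1) (hT : 0 < T) 
    (hint : ∀ t, 0 < t → IntervalIntegrable (fun s => (t - s) ^ (-α) * u s) volume 0 t)
    (hu : IntervalIntegrable u volume 0 T) (hpos : ∀ s ∈ Ioo 0 T, 0 < u s)
    (hu0 : u T = 0) (hud : DifferentiableAt ℝ u T) {d : ℝ} (hd : HasDerivAt (fracInt α u) d T) :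
    d < 0 := by
  obtain ⟨K, hK0, hK⟩ := hud.isBigO_sub.exists_pos
  obtain ⟨ε, hε, hK⟩ := Metric.eventually_nhds_iff.1 hK.bound
  set c := α * T ^ (-α - 1) * ∫ s in (0 : ℝ)..T / 2, u s with hc
  have hcpos : 0 < c := by
    have : 0 < ∫ s in (0 : ℝ)..T / 2, u s := by
      refine intervalIntegral.intervalIntegral_pos_of_pos_on
        (hu.mono_set ?_) (fun s hs => hpos s ⟨hs.1, by linarith [hs.2]⟩) (by linarith)
      rw [uIcc_of_le (by linarith), uIcc_of_le hT.le]
      exact Icc_subset_Icc le_rfl (by linarith)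
    positivity
  have hcurve : HasDerivAt (fun h => fracInt α u (T - h)) (-d) 0 := by
    have := HasDerivAt.comp (𝕜 := ℝ) (x := 0) (h₂ := fracInt α u) (h := fun h => T - h)
      (h₂' := d) (h' := -1) (by simpa using hd) (by simpa using (hasDerivAt_id (0 : ℝ)).const_sub T)
    simpa [Function.comp_def] using this
  have hslope := hcurve.tendsto_slope_zero_right
  have hlim : Tendsto (fun h : ℝ => c - K * h ^ (1 - α)) (𝓝[>] 0) (𝓝 c) := by
    have : ContinuousAt (fun h : ℝ => c - K * h ^ (1 - α)) 0 := by
      have := continuousAt_rpow_const (0 : ℝ) (1 - α) (Or.inr (by linarith))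
      fun_prop
    have h2 := this.tendsto
    rw [zero_rpow (by linarith), mul_zero, sub_zero] at h2
    exact h2.mono_left nhdsWithin_le_nhds
  have hle : c ≤ -d := by
    refine le_of_tendsto_of_tendsto hlim hslope ?_
    filter_upwards [Ioo_mem_nhdsGT (show (0 : ℝ) < T / 2 by linarith), Ioo_mem_nhdsGT hε] with h hh hhε
    have hKh : ∀ s ∈ Ioo (T - h) T, u s ≤ K * (T - s) := fun s hs => by
      have hsT : |s - T| = T - s := by rw [abs_sub_comm, abs_of_pos (by linarith [hs.2])]
      have := hK (y := s) (by rw [Real.dist_eq, hsT]; linarith [hs.1, hhε.2])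
      rw [hu0, sub_zero, norm_eq_abs, norm_eq_abs, hsT] at this
      exact (le_abs_self _).trans this
    have := fracInt_sub_le hα hα1 hT hK0.le hint hu hpos hh.1 hh.2 hKh
    rw [zero_add, sub_zero, smul_eq_mul, inv_mul_eq_div, le_div_iff₀ hh.1]
    rw [← hc] at this
    linarith
  linarith

end MaximumPrinciple

section EntireSeries

/-- Coefficients of a power series that converges everywhere. -/
def EntireCoeff (a : ℕ → ℝ) : Prop := ∀ R : ℝ, 0 < R → Summable fun k => |a k| * R ^ k

/-- The sum of a power series. -/
noncomputable def powerSum (a : ℕ → ℝ) (x : ℝ) : ℝ := ∑' k : ℕ, a k * x ^ k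

theorem powerSum_zero (a : ℕ → ℝ) : powerSum a 0 = a 0 := by
  rw [powerSum, tsum_eq_single 0 fun k hk => by simp [hk]]
  simp

theorem powerSum_const_mul (c : ℝ) (a : ℕ → ℝ) (x : ℝ) :
    powerSum (fun k => c * a k) x = c * powerSum a x := by
  simp only [powerSum, mul_assoc, tsum_mul_left]

theorem EntireCoeff.hasDerivAt {a : ℕ → ℝ} (ha : EntireCoeff a) (x : ℝ) :
    HasDerivAt (powerSum a) (powerSum (fun k => (k + 1) * a (k + 1)) x) x := by
  set R := |x| + 1 with hR
  have hR0 : 0 < R := by positivity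
  have hsum : Summable fun k => |a k| * (2 * R) ^ k / R := (ha (2 * R) (by positivity)).div_const R
  have hbound : ∀ k : ℕ, ∀ y ∈ Metric.ball (0 : ℝ) R,
      ‖a k * (k * y ^ (k - 1))‖ ≤ |a k| * (2 * R) ^ k / R := by
    intro k y hy
    have hy : |y| ≤ R := by simpa using (mem_ball_zero_iff.1 hy).le
    rcases k with _ | k
    · simp; positivity
    · have h2 : ((k + 1 : ℕ) : ℝ) ≤ 2 ^ (k + 1) := by exact_mod_cast Nat.lt_two_pow_self.le
      rw [norm_mul, norm_mul, norm_pow, norm_eq_abs, norm_eq_abs, norm_eq_abs, mul_div_assoc,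
        Nat.add_sub_cancel, Nat.abs_cast]
      have : (2 * R) ^ (k + 1) / R = 2 ^ (k + 1) * R ^ k := by
        rw [mul_pow, pow_succ R]; field_simp
      rw [this]
      gcongr
  have h := hasDerivAt_tsum_of_isPreconnected hsum Metric.isOpen_ball
    (convex_ball (0 : ℝ) R).isPreconnected
    (g := fun k y => a k * y ^ k) (g' := fun k y => a k * (k * y ^ (k - 1)))
    (fun k y _ => (hasDerivAt_pow k y).const_mul (a k)) hbound (Metric.mem_ball_self hR0)
    (summable_of_ne_finset_zero (s := {0}) fun k hk => by
      simp only [Finset.mem_singleton] at hk; simp [hk])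
    (show x ∈ Metric.ball (0 : ℝ) R by simp [hR])
  refine h.congr_deriv ?_
  rw [Summable.tsum_eq_zero_add]
  · simp only [Nat.cast_zero, zero_mul, mul_zero, zero_add, powerSum, Nat.add_sub_cancel]
    push_cast
    exact tsum_congr fun k => by ring
  · exact Summable.of_norm_bounded hsum fun k => hbound k x (by simp [hR])

theorem EntireCoeff.continuous {a : ℕ → ℝ} (ha : EntireCoeff a) : Continuous (powerSum a) :=
  continuous_iff_continuousAt.2 fun x => (ha.hasDerivAt x).continuousAt

theorem exp_neg_mul_rpow_le_Gamma {A y : ℝ} (hA : 0 < A) (hy : 1 ≤ y) :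
    exp (-A) * A ^ (y - 1) ≤ Gamma y := by
  have hy0 : 0 < y := by linarith
  rw [Gamma_eq_integral hy0, ← integral_exp_neg_Ioi A, ← integral_mul_const]
  have hG := GammaIntegral_convergent hy0
  have hsub : Ioi A ⊆ Ioi 0 := Ioi_subset_Ioi hA.le
  have hexp : IntegrableOn (fun x : ℝ => exp (-x)) (Ioi A) := by
    simpa using exp_neg_integrableOn_Ioi A one_pos
  calc ∫ x in Ioi A, exp (-x) * A ^ (y - 1) ≤ ∫ x in Ioi A, exp (-x) * x ^ (y - 1) := by
        refine setIntegral_mono_on (hexp.mul_const _) (hG.mono_set hsub)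
          measurableSet_Ioi fun x hx => ?_
        have hx : A < x := hx
        gcongr
    _ ≤ ∫ x in Ioi 0, exp (-x) * x ^ (y - 1) := by
        refine setIntegral_mono_set hG ?_ hsub.eventuallyLE
        filter_upwards [self_mem_ae_restrict measurableSet_Ioi] with x hx
        have hx : 0 < x := hx
        simp only [Pi.zero_apply]
        positivity

theorem entireCoeff_of_le_div_Gamma {α β C : ℝ} (hα : 0 < α) (hβ : 0 < β) {a : ℕ → ℝ}
    (ha : ∀ k : ℕ, |a k| ≤ C * ((k + 1) / Gamma (α * k + β))) : EntireCoeff a := by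
  intro R hR
  have hC : 0 ≤ C := by
    have h := (abs_nonneg _).trans (ha 0)
    have : 0 < Gamma (α * (0 : ℕ) + β) := Gamma_pos_of_pos (by simpa)
    exact nonneg_of_mul_nonneg_left h (by positivity)
  set A := (2 * R) ^ (1 / α) with hAdef
  have hA : 0 < A := by positivity
  have hAα : A ^ α = 2 * R := by
    rw [hAdef, ← rpow_mul (by positivity), one_div_mul_cancel hα.ne', rpow_one]
  set D := C * (exp A * A ^ (1 - β)) with hD
  have hgeom : Summable fun k : ℕ => D * (((k : ℝ) + 1) * (1 / 2 : ℝ) ^ k) := by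
    have h1 := summable_pow_mul_geometric_of_norm_lt_one (R := ℝ) 1 (r := 1 / 2)
      (by rw [norm_eq_abs, abs_of_pos] <;> norm_num)
    have h2 : Summable fun k : ℕ => (1 / 2 : ℝ) ^ k := summable_geometric_two
    refine ((h1.add h2).congr fun k => ?_).mul_left D
    ring
  refine Summable.of_norm_bounded_eventually_nat hgeom ?_
  have hlarge : ∀ᶠ k : ℕ in atTop, 1 ≤ α * k + β := by
    have : Tendsto (fun k : ℕ => α * (k : ℝ) + β) atTop atTop :=
      tendsto_atTop_add_const_right _ _ (tendsto_natCast_atTop_atTop.const_mul_atTop hα)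
    exact this.eventually_ge_atTop 1
  filter_upwards [hlarge] with k hk
  have hΓ := exp_neg_mul_rpow_le_Gamma hA hk
  have hpow : A ^ (α * k + β - 1) = (2 * R) ^ k / A ^ (1 - β) := by
    rw [show α * k + β - 1 = α * k - (1 - β) by ring, rpow_sub hA, rpow_mul hA.le, hAα,
      rpow_natCast]
  rw [norm_mul, norm_pow, norm_eq_abs, norm_eq_abs, abs_abs, abs_of_pos hR]
  have hpos : 0 < exp (-A) * A ^ (α * k + β - 1) := by positivity
  calc |a k| * R ^ k ≤ C * ((k + 1) / (exp (-A) * A ^ (α * k + β - 1))) * R ^ k := by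
        refine mul_le_mul_of_nonneg_right ((ha k).trans ?_) (by positivity)
        gcongr
    _ = D * (((k : ℝ) + 1) * (1 / 2 : ℝ) ^ k) := by
        rw [hpow, hD, exp_neg, mul_pow, one_div_pow]
        field_simp

end EntireSeries

section FractionalIntegral

variable {α β : ℝ} {a b : ℕ → ℝ}

theorem fracInt_powerSum (hα : 0 < α) (hα1 : α < 1) (hβ : 0 < β)
    (hab : ∀ k : ℕ, b k = a k * Gamma (α * k + β) / Gamma (α * k + β + (1 - α)))
    (hb : EntireCoeff b) {t : ℝ} (ht : 0 < t) :
    fracInt α (fun s => s ^ (β - 1) * powerSum a (s ^ α)) t =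
      Gamma (1 - α) * (t ^ (β - α) * powerSum b (t ^ α)) := by
  have hγ : ∀ k : ℕ, 0 < α * k + β := fun k => by positivity
  have hα' : 0 < 1 - α := by linarith
  set f : ℕ → ℝ → ℝ := fun k s => s ^ (α * k + β - 1) * (t - s) ^ (1 - α - 1) with hf
  have hfint : ∀ k, IntegrableOn (f k) (Ioc 0 t) := fun k =>
    (intervalIntegrable_iff_integrableOn_Ioc_of_le ht.le).1
      (intervalIntegrable_rpow_mul_sub_rpow (hγ k) hα' ht)
  have hfval : ∀ k, ∫ s in Ioc 0 t, f k s = t ^ (β - α) * (t ^ α) ^ k *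
      (Gamma (1 - α) * (Gamma (α * k + β) / Gamma (α * k + β + (1 - α)))) := fun k => by
    rw [← intervalIntegral.integral_of_le ht.le, integral_rpow_mul_sub_rpow (hγ k) hα' ht,
      ProbabilityTheory.beta, show α * k + β + (1 - α) - 1 = β - α + α * k by ring,
      rpow_add ht, rpow_mul ht.le, rpow_natCast]
    ring
  have hterm : ∀ k, ∫ s in Ioc 0 t, a k * f k s =
      Gamma (1 - α) * (t ^ (β - α) * (b k * (t ^ α) ^ k)) := fun k => by
    rw [integral_const_mul, hfval, hab]
    ring
  have hnorm : ∀ k, ∫ s in Ioc 0 t, ‖a k * f k s‖ =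
      Gamma (1 - α) * (t ^ (β - α) * (|b k| * (t ^ α) ^ k)) := fun k => by
    have : ∫ s in Ioc 0 t, ‖a k * f k s‖ = ∫ s in Ioc 0 t, |a k| * f k s := by
      refine setIntegral_congr_fun measurableSet_Ioc fun s hs => ?_
      have h1 : 0 ≤ t - s := sub_nonneg.2 hs.2
      have h2 : 0 < s := hs.1
      have h3 : 0 ≤ f k s := by simp only [hf]; positivity
      simp only [norm_mul, norm_eq_abs, abs_of_nonneg h3]
    have hG1 := Gamma_pos_of_pos (hγ k)
    have hG2 : 0 < Gamma (α * k + β + (1 - α)) := Gamma_pos_of_pos (by linarith [hγ k])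
    rw [this, integral_const_mul, hfval, hab, abs_div, abs_mul, abs_of_pos hG1, abs_of_pos hG2]
    ring
  have hsum := hasSum_integral_of_summable_integral_norm (μ := volume.restrict (Ioc 0 t))
    (F := fun k s => a k * f k s) (fun k => (hfint k).const_mul _)
    (by simp only [hnorm]; exact ((hb _ (by positivity)).mul_left _).mul_left _)
  rw [fracInt, intervalIntegral.integral_of_le ht.le, powerSum, ← tsum_mul_left, ← tsum_mul_left,
    ← tsum_congr hterm, hsum.tsum_eq]
  refine setIntegral_congr_fun measurableSet_Ioc fun s hs => ?_
  simp only [powerSum, ← tsum_mul_left]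
  refine tsum_congr fun k => ?_
  have hs0 : 0 < s := hs.1
  simp only [hf]
  rw [show α * k + β - 1 = β - 1 + α * k by ring, rpow_add hs0, rpow_mul hs0.le, rpow_natCast,
    show (1 : ℝ) - α - 1 = -α by ring]
  ring

/-- A maximum principle: if the fractional integral of `s ^ (β - 1) * φ (s ^ α)` does not decrease
at the zeros of `φ`, then `φ` has no zeros. -/
theorem pos_of_fracInt_eq {φ G : ℝ → ℝ} (hα : 0 < α) (hα1 : α < 1) (hβ : 0 < β)
    (hφ : Differentiable ℝ φ) (hφ0 : 0 < φ 0)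
    (hG : ∀ t, 0 < t → fracInt α (fun s => s ^ (β - 1) * φ (s ^ α)) t = G (t ^ α))
    (hd : ∀ x, 0 < x → φ x = 0 → ∃ d, 0 ≤ d ∧ HasDerivAt G d x) {x : ℝ} (hx : 0 ≤ x) :
    0 < φ x := by
  by_contra! hneg
  have hcpt : IsCompact (Icc 0 x ∩ {y | φ y ≤ 0}) :=
    isCompact_Icc.inter_right (isClosed_le hφ.continuous continuous_const)
  obtain ⟨z, ⟨⟨hz0, hzx⟩, hzneg⟩, hzmin⟩ := hcpt.exists_isLeast ⟨x, ⟨hx, le_rfl⟩, hneg⟩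
  have hzneg : φ z ≤ 0 := hzneg
  have hzeq : φ z = 0 := by
    obtain ⟨y, hy, hy0⟩ := intermediate_value_Icc' hz0 hφ.continuous.continuousOn ⟨hzneg, hφ0.le⟩
    have : z ≤ y := hzmin ⟨⟨hy.1, hy.2.trans hzx⟩, hy0.le⟩
    rwa [le_antisymm this hy.2]
  have hzpos : 0 < z := hz0.lt_of_ne fun h => by rw [← h] at hzneg; linarith
  have hbefore : ∀ y, 0 ≤ y → y < z → 0 < φ y := fun y hy hyz => by
    by_contra! h
    exact absurd (hzmin ⟨⟨hy, hyz.le.trans hzx⟩, h⟩) (not_le.2 hyz)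
  set T := z ^ (1 / α) with hT
  have hT0 : 0 < T := by positivity
  have hTα : T ^ α = z := by rw [hT, ← rpow_mul hz0, one_div_mul_cancel hα.ne', rpow_one]
  have hcont : Continuous fun s : ℝ => φ (s ^ α) :=
    hφ.continuous.comp (continuous_id.rpow_const fun _ => Or.inr hα.le)
  have hrpow : HasDerivAt (fun s : ℝ => s ^ α) (α * T ^ (α - 1)) T :=
    hasDerivAt_rpow_const (Or.inl hT0.ne')
  obtain ⟨d, hd0, hGd⟩ := hd z hzpos hzeq
  have hW : HasDerivAt (fracInt α fun s => s ^ (β - 1) * φ (s ^ α)) (d * (α * T ^ (α - 1))) T := by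
    rw [← hTα] at hGd
    refine (hGd.comp T hrpow).congr_of_eventuallyEq ?_
    filter_upwards [lt_mem_nhds hT0] with t ht using hG t ht
  have hlt := fracInt_deriv_neg hα hα1 hT0 ?_ ?_ ?_ ?_ ?_ hW
  · exact absurd hlt (not_lt.2 (by positivity))
  · intro t ht
    have := (intervalIntegrable_rpow_mul_sub_rpow hβ (sub_pos.2 hα1) ht).mul_continuousOn
      hcont.continuousOn
    refine this.congr fun s _ => ?_
    simp only [show (1 : ℝ) - α - 1 = -α by ring]
    ring
  · exact (intervalIntegral.intervalIntegrable_rpow' (by linarith)).mul_continuousOn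
      hcont.continuousOn
  · intro s hs
    have hs0 : 0 < s := hs.1
    refine mul_pos (by positivity) (hbefore _ (by positivity) ?_)
    rw [← hTα]
    exact rpow_lt_rpow hs0.le hs.2 hα
  · simp [hTα, hzeq]
  · refine (hasDerivAt_rpow_const (Or.inl hT0.ne')).differentiableAt.mul ?_
    exact (hφ (T ^ α)).comp T hrpow.differentiableAt

end FractionalIntegral

section MittagLeffler

variable {α : ℝ}

/-- Coefficients of `E_{α,β}(-x)`. -/
noncomputable def mlCoeff (α β : ℝ) (k : ℕ) : ℝ := (-1) ^ k / Gamma (α * k + β)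

/-- Coefficients of the negative of the derivative of `E_{α,α}(-x)`. -/
noncomputable def mlDerivCoeff (α : ℝ) (k : ℕ) : ℝ := (-1) ^ k * (k + 1) / Gamma (α * k + 2 * α)

theorem mlE_neg (α β x : ℝ) : mlE α β (-x) = powerSum (mlCoeff α β) x := by
  refine tsum_congr fun k => ?_
  rw [neg_pow, mlCoeff]
  ring

theorem entireCoeff_mlCoeff {β : ℝ} (hα : 0 < α) (hβ : 0 < β) : EntireCoeff (mlCoeff α β) := by
  refine entireCoeff_of_le_div_Gamma (C := 1) hα hβ fun k => ?_
  have hG : 0 < Gamma (α * k + β) := Gamma_pos_of_pos (by positivity)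
  rw [mlCoeff, abs_div, abs_pow, abs_neg, abs_one, one_pow, abs_of_pos hG, one_mul]
  gcongr
  simp

theorem entireCoeff_mlDerivCoeff (hα : 0 < α) : EntireCoeff (mlDerivCoeff α) := by
  refine entireCoeff_of_le_div_Gamma (C := 1) (β := 2 * α) hα (by positivity) fun k => ?_
  have hG : 0 < Gamma (α * k + 2 * α) := Gamma_pos_of_pos (by positivity)
  have hk : (0 : ℝ) < k + 1 := by positivity
  rw [mlDerivCoeff, abs_div, abs_mul, abs_pow, abs_neg, abs_one, one_pow, abs_of_pos hG,
    abs_of_pos hk, one_mul, one_mul]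

theorem hasDerivAt_mlCoeff_one (hα : 0 < α) (x : ℝ) :
    HasDerivAt (powerSum (mlCoeff α 1)) (-α⁻¹ * powerSum (mlCoeff α α) x) x := by
  refine ((entireCoeff_mlCoeff hα one_pos).hasDerivAt x).congr_deriv ?_
  rw [← powerSum_const_mul]
  congr 1
  funext k
  have hy : 0 < α * k + α := by positivity
  have hG : Gamma (α * k + α) ≠ 0 := (Gamma_pos_of_pos hy).ne'
  have hk : (k : ℝ) + 1 ≠ 0 := by positivity
  simp only [mlCoeff]
  push_cast
  rw [mul_add, mul_one, Gamma_add_one hy.ne', show α * k + α = α * (k + 1) by ring] at *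
  field_simp
  ring

theorem hasDerivAt_mlCoeff_self (hα : 0 < α) (x : ℝ) :
    HasDerivAt (powerSum (mlCoeff α α)) (-powerSum (mlDerivCoeff α) x) x := by
  refine ((entireCoeff_mlCoeff hα hα).hasDerivAt x).congr_deriv ?_
  rw [← neg_one_mul, ← powerSum_const_mul]
  congr 1
  funext k
  simp only [mlCoeff, mlDerivCoeff]
  push_cast
  rw [show α * ((k : ℝ) + 1) + α = α * k + 2 * α by ring]
  ring

theorem fracInt_mlCoeff_self (hα : 0 < α) (hα1 : α < 1) {t : ℝ} (ht : 0 < t) :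
    fracInt α (fun s => s ^ (α - 1) * powerSum (mlCoeff α α) (s ^ α)) t =
      Gamma (1 - α) * powerSum (mlCoeff α 1) (t ^ α) := by
  rw [fracInt_powerSum (b := mlCoeff α 1) hα hα1 hα (fun k => ?_)
    (entireCoeff_mlCoeff hα one_pos) ht]
  · simp
  · have hG : Gamma (α * k + α) ≠ 0 := (Gamma_pos_of_pos (by positivity)).ne'
    rw [mlCoeff, mlCoeff, div_mul_cancel₀ _ hG, show α * k + α + (1 - α) = α * k + 1 by ring]

theorem fracInt_mlDerivCoeff (hα : 0 < α) (hα1 : α < 1) {t : ℝ} (ht : 0 < t) :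
    fracInt α (fun s => s ^ (2 * α - 1) * powerSum (mlDerivCoeff α) (s ^ α)) t =
      Gamma (1 - α) * α⁻¹ * (t ^ α * powerSum (mlCoeff α α) (t ^ α)) := by
  have hb : EntireCoeff fun k => α⁻¹ * mlCoeff α α k := fun R hR => by
    simp only [abs_mul, mul_assoc]
    exact (entireCoeff_mlCoeff hα hα R hR).mul_left _
  rw [fracInt_powerSum (b := fun k => α⁻¹ * mlCoeff α α k) hα hα1 (by positivity) (fun k => ?_) hb
    ht, powerSum_const_mul, show 2 * α - α = α by ring]
  · ring
  · have hy : 0 < α * k + α := by positivity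
    have hG : Gamma (α * k + α) ≠ 0 := (Gamma_pos_of_pos hy).ne'
    have hG2 : Gamma (α * k + 2 * α) ≠ 0 := (Gamma_pos_of_pos (by positivity)).ne'
    have hk : (k : ℝ) + 1 ≠ 0 := by positivity
    rw [mlCoeff, mlDerivCoeff, div_mul_cancel₀ _ hG2,
      show α * k + 2 * α + (1 - α) = α * k + α + 1 by ring, Gamma_add_one hy.ne']
    rw [show α * k + α = α * (k + 1) by ring] at *
    field_simp

theorem powerSum_mlCoeff_self_pos (hα : 0 < α) (hα1 : α < 1) {x : ℝ} (hx : 0 ≤ x) :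
    0 < powerSum (mlCoeff α α) x := by
  refine pos_of_fracInt_eq (G := fun y => Gamma (1 - α) * powerSum (mlCoeff α 1) y) hα hα1 hα
    (fun y => (hasDerivAt_mlCoeff_self hα y).differentiableAt) ?_
    (fun t ht => fracInt_mlCoeff_self hα hα1 ht) (fun y _ hy => ⟨0, le_rfl, ?_⟩) hx
  · simpa [powerSum_zero, mlCoeff] using Gamma_pos_of_pos hα
  · simpa [hy] using (hasDerivAt_mlCoeff_one hα y).const_mul (Gamma (1 - α))

theorem powerSum_mlDerivCoeff_pos (hα : 0 < α) (hα1 : α < 1) {x : ℝ} (hx : 0 ≤ x) :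
    0 < powerSum (mlDerivCoeff α) x := by
  have hG : 0 < Gamma (1 - α) := Gamma_pos_of_pos (by linarith)
  refine pos_of_fracInt_eq (β := 2 * α)
    (G := fun y => Gamma (1 - α) * α⁻¹ * (y * powerSum (mlCoeff α α) y)) hα hα1 (by positivity)
    (fun y => ((entireCoeff_mlDerivCoeff hα).hasDerivAt y).differentiableAt) ?_
    (fun t ht => fracInt_mlDerivCoeff hα hα1 ht)
    (fun y hy0 hy => ⟨Gamma (1 - α) * α⁻¹ * powerSum (mlCoeff α α) y, ?_, ?_⟩) hx
  · simpa [powerSum_zero, mlDerivCoeff] using Gamma_pos_of_pos (show 0 < 2 * α by positivity)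
  · have := powerSum_mlCoeff_self_pos hα hα1 hy0.le
    positivity
  · have := ((hasDerivAt_id y).mul (hasDerivAt_mlCoeff_self hα y)).const_mul (Gamma (1 - α) * α⁻¹)
    simpa [hy] using this

theorem powerSum_mlCoeff_one_nonneg (hα : 0 < α) (hα1 : α < 1) {x : ℝ} (hx : 0 ≤ x) :
    0 ≤ powerSum (mlCoeff α 1) x := by
  rcases hx.eq_or_lt with rfl | hx
  · simp [powerSum_zero, mlCoeff]
  set t := x ^ (1 / α) with ht
  have ht0 : 0 < t := by positivity
  have htα : t ^ α = x := by rw [ht, ← rpow_mul hx.le, one_div_mul_cancel hα.ne', rpow_one]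
  have h := fracInt_mlCoeff_self hα hα1 ht0
  rw [htα] at h
  refine nonneg_of_mul_nonneg_right (a := Gamma (1 - α)) ?_ (Gamma_pos_of_pos (by linarith))
  rw [← h]
  refine intervalIntegral.integral_nonneg ht0.le fun s hs => ?_
  have h1 : 0 ≤ s := hs.1
  have h2 : 0 ≤ t - s := sub_nonneg.2 hs.2
  have := powerSum_mlCoeff_self_pos hα hα1 (rpow_nonneg h1 α)
  positivity

theorem mul_powerSum_mlCoeff_self_le (hα : 0 < α) (hα1 : α < 1) {x : ℝ} (hx : 0 ≤ x) :
    x * powerSum (mlCoeff α α) x ≤ α := by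
  have hder : ∀ y, HasDerivAt
      (fun y => α * powerSum (mlCoeff α 1) y + y * powerSum (mlCoeff α α) y)
      (-(y * powerSum (mlDerivCoeff α) y)) y := fun y => by
    refine (((hasDerivAt_mlCoeff_one hα y).const_mul α).add
      ((hasDerivAt_id y).mul (hasDerivAt_mlCoeff_self hα y))).congr_deriv ?_
    simp only [id]
    field_simp
    ring
  have hanti := antitoneOn_of_deriv_nonpos (convex_Ici (0 : ℝ))
    (fun y _ => (hder y).continuousAt.continuousWithinAt)
    (fun y _ => (hder y).differentiableAt.differentiableWithinAt) fun y hy => by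
      rw [interior_Ici] at hy
      have hy : 0 < y := hy
      have := powerSum_mlDerivCoeff_pos hα hα1 hy.le
      rw [(hder y).deriv, neg_nonpos]
      positivity
  have h := hanti self_mem_Ici (show x ∈ Ici 0 from hx) hx
  simp only [powerSum_zero] at h
  have h0 : mlCoeff α 1 0 = 1 := by simp [mlCoeff]
  rw [h0] at h
  have := mul_nonneg hα.le (powerSum_mlCoeff_one_nonneg hα hα1 hx)
  linarith

theorem powerSum_mlCoeff_self_le (hα : 0 < α) (hα1 : α < 1) {x : ℝ} (hx : 0 ≤ x) :
    powerSum (mlCoeff α α) x ≤ (Gamma α)⁻¹ := by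
  have hanti := antitoneOn_of_deriv_nonpos (convex_Ici (0 : ℝ))
    (fun y _ => (hasDerivAt_mlCoeff_self hα y).continuousAt.continuousWithinAt)
    (fun y _ => (hasDerivAt_mlCoeff_self hα y).differentiableAt.differentiableWithinAt)
    fun y hy => by
      rw [interior_Ici] at hy
      have hy : 0 < y := hy
      rw [(hasDerivAt_mlCoeff_self hα y).deriv, neg_nonpos]
      exact (powerSum_mlDerivCoeff_pos hα hα1 hy.le).le
  have h := hanti self_mem_Ici (show x ∈ Ici 0 from hx) hx
  simpa [powerSum_zero, mlCoeff] using h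

theorem mlE_one_one (z : ℝ) : mlE 1 1 z = exp z := by
  rw [exp_eq_exp_ℝ, NormedSpace.exp_eq_tsum_div]
  refine tsum_congr fun k => ?_
  rw [one_mul, Gamma_nat_eq_factorial]

theorem one_add_mul_abs_mlE_neg_le (hα : 0 < α) (hα1 : α ≤ 1) {x : ℝ} (hx : 0 ≤ x) :
    (1 + x) * |mlE α α (-x)| ≤ α + (Gamma α)⁻¹ := by
  rcases hα1.eq_or_lt with rfl | hα1
  · rw [mlE_one_one, abs_exp, Gamma_one, inv_one]
    have h1 := add_one_le_exp x
    have h2 : exp x * exp (-x) = 1 := by rw [← exp_add, add_neg_cancel, exp_zero]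
    nlinarith [exp_pos (-x)]
  · rw [mlE_neg, abs_of_pos (powerSum_mlCoeff_self_pos hα hα1 hx)]
    linarith [mul_powerSum_mlCoeff_self_le hα hα1 hx, powerSum_mlCoeff_self_le hα hα1 hx]

end MittagLeffler

theorem mittagLeffler_decay_bound (α : ℝ) (hα : 0 < α) (hα1 : α ≤ 1) :
    ∃ C > 0, ∀ lam s : ℝ, 0 < s →
      |mlE α α (-(lam ^ 2) * s ^ α)| ≤ C / (1 + lam ^ 2 * s ^ α) := by
  have hG := Gamma_pos_of_pos hα
  refine ⟨α + (Gamma α)⁻¹, by positivity, fun lam s hs => ?_⟩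
  rw [neg_mul, le_div_iff₀ (by positivity), mul_comm]
  exact one_add_mul_abs_mlE_neg_le hα hα1 (by positivity)
end
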